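/- Let T be a decomposition tree whose labels all lie in [0,1], and let u₀ ∈ [0,1] be a real number. If acc(T) > u₀, then for every internal node labeled (d, m) occurring anywhere in T (as a subtree of T), the product d · m satisfies d · m > u₀. (Recursive form of the decomposition and merging requirement: for recursive decomposition to achieve accuracy exceeding u₀, the joint decomposition-and-merging accuracy at every level of the recursion must exceed u₀.) -/

import Mathlib

inductive DTree where
  | leaf (u : ℝ)
  | node (d m : ℝ) (cs : List DTree)

noncomputable def DTree.acc : DTree → ℝ
  | .leaf u => u
  | .node d m cs => d * m * (cs.attach.map (fun t => DTree.acc t.1)).prod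
decreasing_by
  have := List.sizeOf_lt_of_mem t.2
  simp only [DTree.node.sizeOf_spec]
  omega

inductive DTree.LabelsIn01 : DTree → Prop
  | leaf {u : ℝ} : 0 ≤ u → u ≤ 1 → DTree.LabelsIn01 (.leaf u)
  | node {d m : ℝ} {cs : List DTree} : 0 ≤ d → d ≤ 1 → 0 ≤ m → m ≤ 1 →
      (∀ t ∈ cs, DTree.LabelsIn01 t) → DTree.LabelsIn01 (.node d m cs)

inductive DTree.IsSubtree : DTree → DTree → Prop
  | refl (t : DTree) : DTree.IsSubtree t t
  | child {t c : DTree} {d m : ℝ} {cs : List DTree} :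
      c ∈ cs → DTree.IsSubtree t c → DTree.IsSubtree t (.node d m cs)

inductive DTree.LeafOccurs : ℝ → DTree → Prop
  | leaf (u : ℝ) : DTree.LeafOccurs u (.leaf u)
  | node {u d m : ℝ} {cs : List DTree} {c : DTree} :
      c ∈ cs → DTree.LeafOccurs u c → DTree.LeafOccurs u (.node d m cs)

theorem DTree.acc_node (d m : ℝ) (cs : List DTree) :
    (DTree.node d m cs).acc = d * m * (cs.map DTree.acc).prod := by
  rw [DTree.acc, List.attach_map_val]

theorem List.prod_mem_Icc_zero_one {l : List ℝ} (h : ∀ x ∈ l, x ∈ Set.Icc (0 : ℝ) 1) :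
    l.prod ∈ Set.Icc (0 : ℝ) 1 := by
  induction l with
  | nil => simp
  | cons a l ih =>
    rw [List.forall_mem_cons] at h
    rw [List.prod_cons]
    exact unitInterval.mul_mem h.1 (ih h.2)

theorem List.prod_le_of_mem_of_mem_Icc_zero_one {l : List ℝ} (h : ∀ x ∈ l, x ∈ Set.Icc (0 : ℝ) 1)
    {a : ℝ} (ha : a ∈ l) : l.prod ≤ a := by
  rw [← List.prod_erase ha]
  exact mul_le_of_le_one_right (h a ha).1
    (List.prod_mem_Icc_zero_one fun x hx => h x (List.mem_of_mem_erase hx)).2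

theorem DTree.LabelsIn01.acc_mem_Icc {T : DTree} (hT : T.LabelsIn01) :
    T.acc ∈ Set.Icc (0 : ℝ) 1 := by
  induction hT with
  | leaf h0 h1 => rw [DTree.acc]; exact ⟨h0, h1⟩
  | node hd0 hd1 hm0 hm1 _ ih =>
    rw [DTree.acc_node]
    exact unitInterval.mul_mem (unitInterval.mul_mem ⟨hd0, hd1⟩ ⟨hm0, hm1⟩)
      (List.prod_mem_Icc_zero_one (by simpa using ih))

theorem DTree.LabelsIn01.acc_node_le_mul {d m : ℝ} {cs : List DTree}
    (h : (DTree.node d m cs).LabelsIn01) : (DTree.node d m cs).acc ≤ d * m := by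
  cases h with
  | node hd0 _ hm0 _ hcs =>
    rw [DTree.acc_node]
    refine mul_le_of_le_one_right (mul_nonneg hd0 hm0) (List.prod_mem_Icc_zero_one ?_).2
    exact List.forall_mem_map.2 fun t ht => (hcs t ht).acc_mem_Icc

theorem DTree.LabelsIn01.acc_node_le_of_mem {d m : ℝ} {cs : List DTree}
    (h : (DTree.node d m cs).LabelsIn01) {c : DTree} (hc : c ∈ cs) :
    (DTree.node d m cs).acc ≤ c.acc := by
  cases h with
  | node hd0 hd1 hm0 hm1 hcs =>
    have hl : ∀ x ∈ cs.map DTree.acc, x ∈ Set.Icc (0 : ℝ) 1 :=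
      List.forall_mem_map.2 fun t ht => (hcs t ht).acc_mem_Icc
    rw [DTree.acc_node]
    exact (mul_le_of_le_one_left (List.prod_mem_Icc_zero_one hl).1
      (mul_le_one₀ hd1 hm0 hm1)).trans
        (List.prod_le_of_mem_of_mem_Icc_zero_one hl (List.mem_map_of_mem hc))

theorem DTree.IsSubtree.labelsIn01_and_acc_le {S T : DTree} (h : DTree.IsSubtree S T)
    (hT : T.LabelsIn01) : S.LabelsIn01 ∧ T.acc ≤ S.acc := by
  induction h with
  | refl => exact ⟨hT, le_rfl⟩
  | child hc _ ih =>
    have hle := hT.acc_node_le_of_mem hc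
    cases hT with
    | node _ _ _ _ hcs =>
      obtain ⟨hS, hacc⟩ := ih (hcs _ hc)
      exact ⟨hS, hle.trans hacc⟩

theorem rdd_tree_decomposition_merging_requirement (T : DTree) (hT : T.LabelsIn01)
    (u₀ : ℝ) (hu₀ : u₀ ∈ Set.Icc (0:ℝ) 1) (h : T.acc > u₀) :
    ∀ (d m : ℝ) (cs : List DTree), DTree.IsSubtree (.node d m cs) T → d * m > u₀ := by
  intro d m cs hsub
  obtain ⟨hS, hacc⟩ := hsub.labelsIn01_and_acc_le hT
  exact h.trans_le (hacc.trans hS.acc_node_le_mul)
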